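/- Define G(z) = lim_{ε→0⁺} (∫_{-∞}^{-ε} + ∫_{ε}^{∞}) (e^{ipz}/(1 − e^{-p})) f̂(p) conj(ĝ(p)) dp for real-valued Schwartz functions f, g and z in the closed strip S = ℝ + i[0,1]. Then G is well-defined on S, continuous on S, analytic in the interior of S, and satisfies the linear growth bound |G(t+is)| ≤ A + B|t| for all t ∈ ℝ, s ∈ [0,1], with constants A, B depending only on f, g. -/

import Mathlib

open MeasureTheory Complex Filter
open scoped FourierTransform

/-- The closed strip `ℝ + i[0,1]`. -/
def closedStrip : Set ℂ := {z : ℂ | 0 ≤ z.im ∧ z.im ≤ 1}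

/-- The open strip `ℝ + i(0,1)`. -/
def openStrip : Set ℂ := {z : ℂ | 0 < z.im ∧ z.im < 1}

namespace PVaux

open Set Topology

/-- The integrand. -/
noncomputable def F (h : ℝ → ℂ) (z : ℂ) (p : ℝ) : ℂ :=
  Complex.exp (Complex.I * (p : ℂ) * z) / (1 - Complex.exp (-(p : ℂ))) * h p

/-- The `z`-derivative of the integrand. -/
noncomputable def F' (h : ℝ → ℂ) (z : ℂ) (p : ℝ) : ℂ :=
  (Complex.I * (p : ℂ)) * F h z p

lemma hasDerivAt_F (h : ℝ → ℂ) (z : ℂ) (p : ℝ) :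
    HasDerivAt (fun z => F h z p) (F' h z p) z := by
  unfold F' F
  have h1 : HasDerivAt (fun z : ℂ => Complex.I * (p : ℂ) * z) (Complex.I * (p : ℂ)) z := by
    simpa using (hasDerivAt_id z).const_mul (Complex.I * (p : ℂ))
  have := ((h1.cexp).div_const (1 - Complex.exp (-(p : ℂ)))).mul_const (h p)
  refine this.congr_deriv ?_
  ring

lemma measurable_F {h : ℝ → ℂ} (hc : Continuous h) (z : ℂ) : Measurable (F h z) := by
  unfold F
  have := hc.measurable
  fun_prop

lemma den_lower {p : ℝ} (hp : 0 < p) : p / (1 + p) ≤ ‖(1 : ℂ) - Complex.exp (-(p : ℂ))‖ := by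
  have h1 : (1 : ℂ) - Complex.exp (-(p : ℂ)) = ((1 - Real.exp (-p) : ℝ) : ℂ) := by
    push_cast; rfl
  rw [h1, Complex.norm_real, Real.norm_eq_abs]
  refine le_trans ?_ (le_abs_self _)
  have h2 : Real.exp (-p) ≤ 1 / (1 + p) := by
    rw [Real.exp_neg, inv_eq_one_div]
    have := Real.add_one_le_exp p
    apply one_div_le_one_div_of_le <;> linarith
  have h3 : p / (1 + p) = 1 - 1 / (1 + p) := by field_simp; ring
  linarith

lemma den_ne {p : ℝ} (hp : 0 < p) : (1 : ℂ) - Complex.exp (-(p : ℂ)) ≠ 0 := by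
  have := den_lower hp
  have h2 : 0 < p / (1 + p) := by positivity
  exact norm_pos_iff.1 (lt_of_lt_of_le h2 this)

lemma div_den_le {p : ℝ} (hp : 0 < p) (w : ℂ) :
    ‖w / ((1 : ℂ) - Complex.exp (-(p : ℂ)))‖ ≤ (1 + p) / p * ‖w‖ := by
  rw [norm_div]
  have h2 : 0 < p / (1 + p) := by positivity
  calc ‖w‖ / ‖(1 : ℂ) - Complex.exp (-(p : ℂ))‖ ≤ ‖w‖ / (p / (1 + p)) := by
        gcongr; exact den_lower hp
    _ = _ := by field_simp

lemma F_neg (h : ℝ → ℂ) (z : ℂ) {p : ℝ} (hp : 0 < p) :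
    F h z (-p) = -(Complex.exp (-(Complex.I * p * z) - p) * h (-p)) /
      (1 - Complex.exp (-(p : ℂ))) := by
  have hd := den_ne hp
  have hd2 : (1 : ℂ) - Complex.exp (p : ℂ) ≠ 0 := by
    intro h0
    apply hd
    rw [Complex.exp_neg, ← sub_eq_zero.1 h0]; simp
  unfold F
  have e1 : Complex.I * ((-p : ℝ) : ℂ) * z = -(Complex.I * p * z) := by push_cast; ring
  have e2 : -((-p : ℝ) : ℂ) = p := by push_cast; ring
  rw [e1, e2, Complex.exp_sub, div_mul_eq_mul_div, div_eq_div_iff hd2 hd]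
  have := Complex.exp_ne_zero (p : ℂ)
  rw [Complex.exp_neg (p : ℂ)]
  field_simp
  ring

lemma norm_e1 {z : ℂ} (hz : z ∈ closedStrip) {p : ℝ} (hp : 0 < p) :
    (Complex.I * p * z).re ≤ 0 := by
  have := mul_nonneg hp.le hz.1
  simpa [Complex.mul_re, Complex.mul_im] using this

lemma norm_e2 {z : ℂ} (hz : z ∈ closedStrip) {p : ℝ} (hp : 0 < p) :
    (-(Complex.I * p * z) - p).re ≤ 0 := by
  have := mul_le_mul_of_nonneg_left hz.2 hp.le
  simp [Complex.mul_re, Complex.mul_im]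
  linarith

lemma norm_exp_le {w : ℂ} (hw : w.re ≤ 0) : ‖Complex.exp w‖ ≤ 1 := by
  rw [Complex.norm_exp]; exact Real.exp_le_one_iff.2 hw

lemma norm_exp_sub {w w' : ℂ} (hw : w.re ≤ 0) (hw' : w'.re ≤ 0) :
    ‖Complex.exp w - Complex.exp w'‖ ≤ ‖w - w'‖ := by
  have := (convex_halfSpace_re_le (0 : ℝ)).norm_image_sub_le_of_norm_deriv_le
    (𝕜 := ℂ) (f := Complex.exp) (C := 1) (x := w') (y := w)
    (fun x _ => Complex.differentiableAt_exp)
    (fun x hx => by rw [Complex.deriv_exp]; exact norm_exp_le hx) hw' hw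
  simpa using this

lemma norm_F_pos (h : ℝ → ℂ) {z : ℂ} (hz : z ∈ closedStrip) {p : ℝ} (hp : 0 < p) :
    ‖F h z p‖ ≤ (1 + p) / p * ‖h p‖ := by
  unfold F
  rw [div_mul_eq_mul_div]
  refine (div_den_le hp _).trans ?_
  gcongr
  rw [norm_mul]
  exact mul_le_of_le_one_left (norm_nonneg _) (norm_exp_le (norm_e1 hz hp))

lemma norm_F_neg (h : ℝ → ℂ) {z : ℂ} (hz : z ∈ closedStrip) {p : ℝ} (hp : 0 < p) :
    ‖F h z (-p)‖ ≤ (1 + p) / p * ‖h (-p)‖ := by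
  rw [F_neg h z hp]
  refine (div_den_le hp _).trans ?_
  gcongr
  rw [norm_neg, norm_mul]
  exact mul_le_of_le_one_left (norm_nonneg _) (norm_exp_le (norm_e2 hz hp))

lemma norm_sum (h : ℝ → ℂ) {z : ℂ} (hz : z ∈ closedStrip) {p : ℝ} (hp : 0 < p) :
    ‖F h z p + F h z (-p)‖ ≤ (1 + p) / p *
      (p * (2 * |z.re| + 3) * ‖h p‖ + ‖h p - h (-p)‖) := by
  rw [F_neg h z hp]
  unfold F
  rw [div_mul_eq_mul_div, ← add_div]
  refine (div_den_le hp _).trans ?_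
  gcongr
  set u := Complex.I * p * z with hu
  have e : Complex.exp u * h p + -(Complex.exp (-u - p) * h (-p)) =
      (Complex.exp u - Complex.exp (-u - p)) * h p + Complex.exp (-u - p) * (h p - h (-p)) := by
    ring
  rw [e]
  refine (norm_add_le _ _).trans ?_
  rw [norm_mul, norm_mul]
  have hA : ‖Complex.exp u - Complex.exp (-u - p)‖ ≤ p * (2 * |z.re| + 3) := by
    refine (norm_exp_sub (norm_e1 hz hp) (norm_e2 hz hp)).trans ?_
    have : u - (-u - p) = p * (2 * Complex.I * z + 1) := by rw [hu]; ring
    rw [this, norm_mul, Complex.norm_real, Real.norm_eq_abs, abs_of_pos hp]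
    gcongr
    refine (norm_add_le _ _).trans ?_
    have h1 : ‖z‖ ≤ |z.re| + 1 := by
      refine (Complex.norm_le_abs_re_add_abs_im z).trans ?_
      rw [abs_of_nonneg hz.1]
      linarith [hz.2]
    simp
    linarith
  have hB := norm_exp_le (norm_e2 hz hp)
  gcongr
  exact mul_le_of_le_one_left (norm_nonneg _) hB

lemma inv_integrable (C : ℝ) : Integrable (fun p : ℝ => C * (1 + p ^ 2)⁻¹) :=
  integrable_inv_one_add_sq.const_mul C

theorem main {h : ℝ → ℂ} (hc : Continuous h) {C : ℝ}
    (h1 : ∀ p : ℝ, (1 + |p|) * ‖h p‖ ≤ C * (1 + p ^ 2)⁻¹)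
    (h2 : ∀ p : ℝ, 0 < p → (1 + p) * ‖h p - h (-p)‖ ≤ p * (C * (1 + p ^ 2)⁻¹)) :
    ∃ (G : ℂ → ℂ) (A B : ℝ),
      (∀ z ∈ closedStrip, Tendsto (fun ε : ℝ => ∫ p in {p : ℝ | ε ≤ |p|}, F h z p)
          (nhdsWithin 0 (Set.Ioi 0)) (nhds (G z))) ∧
      ContinuousOn G closedStrip ∧
      DifferentiableOn ℂ G openStrip ∧
      (∀ t s : ℝ, 0 ≤ s → s ≤ 1 →
        ‖G ((t : ℂ) + (s : ℂ) * Complex.I)‖ ≤ A + B * |t|) := by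
  set W : ℝ → ℝ := fun p => C * (1 + p ^ 2)⁻¹ with hW
  have hWi : Integrable W := inv_integrable C
  have hWi' : IntegrableOn W (Ioi 0) := hWi.integrableOn
  have hp1 : ∀ p : ℝ, 0 < p → (1 + p) * ‖h p‖ ≤ W p := fun p hp => by
    simpa [abs_of_pos hp] using h1 p
  have hp2 : ∀ p : ℝ, 0 < p → (1 + p) * ‖h (-p)‖ ≤ W p := fun p hp => by
    simpa [abs_of_pos hp] using h1 (-p)
  have hm : ∀ z, Measurable (fun p => F h z p + F h z (-p)) := fun z =>
    (measurable_F hc z).add ((measurable_F hc z).comp measurable_neg)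
  -- pointwise bound
  have hb : ∀ z ∈ closedStrip, ∀ p : ℝ, 0 < p →
      ‖F h z p + F h z (-p)‖ ≤ (2 * |z.re| + 4) * W p := by
    intro z hz p hp
    refine (norm_sum h hz hp).trans ?_
    have e : (1 + p) / p * (p * (2 * |z.re| + 3) * ‖h p‖ + ‖h p - h (-p)‖) =
      (2 * |z.re| + 3) * ((1 + p) * ‖h p‖) + ((1 + p) * ‖h p - h (-p)‖) / p := by
      field_simp
    rw [e]
    have a1 : (2 * |z.re| + 3) * ((1 + p) * ‖h p‖) ≤ (2 * |z.re| + 3) * W p := by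
      gcongr; exact hp1 p hp
    have a2 : ((1 + p) * ‖h p - h (-p)‖) / p ≤ W p := by
      rw [div_le_iff₀ hp, mul_comm (W p)]; exact h2 p hp
    linarith
  have hWnn : ∀ p, 0 ≤ W p := fun p => le_trans (by positivity) (h1 p)
  have hint : ∀ z ∈ closedStrip, IntegrableOn (fun p => F h z p + F h z (-p)) (Ioi 0) := by
    intro z hz
    refine Integrable.mono' (hWi'.const_mul (2 * |z.re| + 4)) (hm z).aestronglyMeasurable ?_
    exact (ae_restrict_iff' measurableSet_Ioi).2 (ae_of_all _ fun p hp => hb z hz p hp)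
  refine ⟨fun z => ∫ p in Ioi (0 : ℝ), (F h z p + F h z (-p)),
    4 * ∫ p in Ioi (0 : ℝ), W p, 2 * ∫ p in Ioi (0 : ℝ), W p, ?_, ?_, ?_, ?_⟩
  · intro z hz
    -- rewrite
    have key : ∀ ε : ℝ, 0 < ε → ∫ p in {p : ℝ | ε ≤ |p|}, F h z p =
        ∫ p in Ioi (0 : ℝ), (Ioi ε).indicator (fun p => F h z p + F h z (-p)) p := by
      intro ε hε
      have hfb : ∀ p : ℝ, ε ≤ |p| → ‖F h z p‖ ≤ ε⁻¹ * W p := by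
        intro p hp
        have hpos : 0 < |p| := hε.trans_le hp
        have : ‖F h z p‖ ≤ (1 + |p|) / |p| * ‖h p‖ := by
          rcases le_or_gt 0 p with h0 | h0
          · rw [abs_of_nonneg h0] at hpos ⊢
            exact norm_F_pos h hz hpos
          · rw [abs_of_neg h0] at hpos ⊢
            simpa using norm_F_neg h hz hpos
        refine this.trans ?_
        have e : (1 + |p|) / |p| * ‖h p‖ = |p|⁻¹ * ((1 + |p|) * ‖h p‖) := by
          field_simp
        rw [e]
        have := hWnn p
        gcongr
        exact h1 p
      have hS : MeasurableSet {p : ℝ | ε ≤ |p|} :=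
        measurableSet_le measurable_const measurable_id.abs
      have hI : IntegrableOn (F h z) {p : ℝ | ε ≤ |p|} := by
        refine Integrable.mono' (hWi.const_mul ε⁻¹).integrableOn
          (measurable_F hc z).aestronglyMeasurable ?_
        exact (ae_restrict_iff' hS).2 (ae_of_all _ fun p hp => hfb p hp)
      have hU : {p : ℝ | ε ≤ |p|} = Ici ε ∪ Iic (-ε) := by
        ext p; simp [le_abs, le_neg]
      have hI1 : IntegrableOn (F h z) (Ici ε) := hI.mono_set (by rw [hU]; exact subset_union_left)
      have hI2 : IntegrableOn (F h z) (Iic (-ε)) :=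
        hI.mono_set (by rw [hU]; exact subset_union_right)
      have hI3 : IntegrableOn (fun p => F h z (-p)) (Ioi ε) :=
        IntegrableOn.mono_set (t := Ici ε) (by simpa using hI2.comp_neg_Ici) Ioi_subset_Ici_self
      rw [hU, setIntegral_union _ measurableSet_Iic hI1 hI2, integral_Ici_eq_integral_Ioi,
        ← integral_comp_neg_Ioi,
        ← integral_add (hI1.mono_set Ioi_subset_Ici_self) hI3,
        setIntegral_indicator measurableSet_Ioi, Ioi_inter_Ioi, max_eq_right hε.le]
      rw [Set.disjoint_left]
      intro x hx hx'
      simp only [mem_Ici, mem_Iic] at hx hx'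
      linarith
    have lim : Tendsto (fun ε : ℝ => ∫ p in Ioi (0 : ℝ),
        (Ioi ε).indicator (fun p => F h z p + F h z (-p)) p) (𝓝[>] 0)
        (𝓝 (∫ p in Ioi (0 : ℝ), (F h z p + F h z (-p)))) := by
      refine tendsto_integral_filter_of_dominated_convergence
        (fun p => ‖F h z p + F h z (-p)‖) ?_ ?_ (hint z hz).norm ?_
      · exact Eventually.of_forall fun ε =>
          ((hm z).indicator measurableSet_Ioi).aestronglyMeasurable
      · exact Eventually.of_forall fun ε => ae_of_all _ fun p => norm_indicator_le_norm_self _ _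
      · refine (ae_restrict_iff' measurableSet_Ioi).2 (ae_of_all _ fun p hp => ?_)
        refine tendsto_const_nhds.congr' ?_
        have : ∀ᶠ ε : ℝ in 𝓝[>] 0, ε < p :=
          mem_nhdsWithin_of_mem_nhds (Iio_mem_nhds hp)
        filter_upwards [this] with ε hε
        rw [indicator_of_mem (show p ∈ Ioi ε from hε)]
    refine lim.congr' ?_
    filter_upwards [self_mem_nhdsWithin] with ε hε
    exact (key ε hε).symm
  · intro z hz
    refine continuousWithinAt_of_dominated (bound := fun p => (2 * (|z.re| + 1) + 4) * W p)
      (Eventually.of_forall fun w => (hm w).aestronglyMeasurable) ?_ (hWi'.const_mul _) ?_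
    · have : ∀ᶠ w in 𝓝[closedStrip] z, |w.re| < |z.re| + 1 := by
        refine mem_nhdsWithin_of_mem_nhds ?_
        exact (continuous_abs.comp Complex.continuous_re).continuousAt.eventually_lt
          continuousAt_const (by simp)
      filter_upwards [this, self_mem_nhdsWithin] with w hw hws
      refine (ae_restrict_iff' measurableSet_Ioi).2 (ae_of_all _ fun p hp => ?_)
      refine (hb w hws p hp).trans ?_
      have := hWnn p
      gcongr
    · exact ae_of_all _ fun p => ((hasDerivAt_F h z p).continuousAt.add
        (hasDerivAt_F h z (-p)).continuousAt).continuousWithinAt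
  · intro z hz
    have ho : IsOpen openStrip :=
      (isOpen_lt continuous_const Complex.continuous_im).inter
        (isOpen_lt Complex.continuous_im continuous_const)
    have hsub : ∀ w ∈ openStrip, w ∈ closedStrip := fun w hw => ⟨hw.1.le, hw.2.le⟩
    have hm' : Measurable (fun p => F' h z p + F' h z (-p)) := by
      have a : Measurable (F' h z) := by
        unfold F'
        have := measurable_F hc z
        fun_prop
      exact a.add (a.comp measurable_neg)
    have := (hasDerivAt_integral_of_dominated_loc_of_deriv_le (μ := volume.restrict (Ioi (0 : ℝ)))
      (F := fun z p => F h z p + F h z (-p)) (F' := fun z p => F' h z p + F' h z (-p))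
      (bound := fun p => 2 * W p)
      (ho.mem_nhds hz) (Eventually.of_forall fun w => (hm w).aestronglyMeasurable)
      (hint z (hsub z hz)) hm'.aestronglyMeasurable ?_ (hWi'.const_mul 2) ?_).2
    · exact this.differentiableAt.differentiableWithinAt
    · refine (ae_restrict_iff' measurableSet_Ioi).2 (ae_of_all _ fun p hp w hw => ?_)
      have hp : 0 < p := hp
      refine (norm_add_le _ _).trans ?_
      have b1 : ‖F' h w p‖ ≤ W p := by
        unfold F'
        rw [norm_mul]
        have := norm_F_pos h (hsub w hw) hp
        have e : ‖Complex.I * (p : ℂ)‖ = p := by simp [abs_of_pos hp]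
        rw [e]
        calc p * ‖F h w p‖ ≤ p * ((1 + p) / p * ‖h p‖) := by gcongr
          _ = (1 + p) * ‖h p‖ := by field_simp
          _ ≤ W p := hp1 p hp
      have b2 : ‖F' h w (-p)‖ ≤ W p := by
        unfold F'
        rw [norm_mul]
        have := norm_F_neg h (hsub w hw) hp
        have e : ‖Complex.I * ((-p : ℝ) : ℂ)‖ = p := by simp [abs_of_pos hp]
        rw [e]
        calc p * ‖F h w (-p)‖ ≤ p * ((1 + p) / p * ‖h (-p)‖) := by gcongr
          _ = (1 + p) * ‖h (-p)‖ := by field_simp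
          _ ≤ W p := hp2 p hp
      linarith
    · exact ae_of_all _ fun p w hw => (hasDerivAt_F h w p).add (hasDerivAt_F h w (-p))
  · intro t s hs0 hs1
    have hz : (t : ℂ) + (s : ℂ) * Complex.I ∈ closedStrip := by
      constructor <;> simpa
    have hre : ((t : ℂ) + (s : ℂ) * Complex.I).re = t := by simp
    refine (norm_integral_le_of_norm_le (hWi'.const_mul (2 * |t| + 4)) ?_).trans ?_
    · refine (ae_restrict_iff' measurableSet_Ioi).2 (ae_of_all _ fun p hp => ?_)
      simpa only [hre] using hb _ hz p hp
    · rw [integral_const_mul]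
      apply le_of_eq; ring

/-- Decay and Lipschitz bounds for a Schwartz function. -/
lemma schwartz_bounds (a : SchwartzMap ℝ ℂ) : ∃ C : ℝ, 0 ≤ C ∧
    (∀ p : ℝ, (1 + |p|) ^ 4 * ‖a p‖ ≤ C) ∧ (∀ p q : ℝ, ‖a p - a q‖ ≤ C * |p - q|) := by
  have k0 := fun p => SchwartzMap.one_add_le_sup_seminorm_apply (𝕜 := ℝ) (m := (4, 1)) (k := 4)
    (n := 0) le_rfl zero_le_one a p
  have k1 := fun p => SchwartzMap.one_add_le_sup_seminorm_apply (𝕜 := ℝ) (m := (4, 1)) (k := 0)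
    (n := 1) (by norm_num) le_rfl a p
  set C := (2 : ℝ) ^ (4, 1).1 *
    ((Finset.Iic (4, 1)).sup fun m => SchwartzMap.seminorm ℝ m.1 m.2) a with hC
  have k0' : ∀ p : ℝ, (1 + |p|) ^ 4 * ‖a p‖ ≤ C := fun p => by simpa using k0 p
  refine ⟨C, le_trans (by positivity) (k0' 0), k0', fun p q => ?_⟩
  have := convex_univ.norm_image_sub_le_of_norm_deriv_le (𝕜 := ℝ) (f := a) (C := C)
    (x := q) (y := p) (fun x _ => a.differentiableAt) (fun x _ => ?_) (mem_univ _) (mem_univ _)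
  · simpa using this
  · have := k1 x
    rw [norm_iteratedFDeriv_eq_norm_iteratedDeriv, iteratedDeriv_one] at this
    simpa using this

end PVaux

/-- The principal-value two-point function
`G(z) = lim_{ε→0⁺} ∫_{|p|≥ε} (e^{ipz}/(1 − e^{-p})) f̂(p) conj(ĝ(p)) dp` for real-valued
Schwartz functions `f, g` exists for every `z` in the closed strip `S = ℝ + i[0,1]`, is
continuous on `S`, analytic in the interior, and satisfies `|G(t+is)| ≤ A + B|t|` on `S`
with constants `A, B` depending only on `f, g`. -/
theorem principal_value_two_point_function (f g : SchwartzMap ℝ ℝ) :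
    ∃ (G : ℂ → ℂ) (A B : ℝ),
      (∀ z ∈ closedStrip,
        Tendsto (fun ε : ℝ =>
            ∫ p in {p : ℝ | ε ≤ |p|},
              Complex.exp (Complex.I * (p : ℂ) * z) / (1 - Complex.exp (-(p : ℂ))) *
                (𝓕 (fun x : ℝ => (f x : ℂ)) p) *
                (starRingEnd ℂ) (𝓕 (fun x : ℝ => (g x : ℂ)) p))
          (nhdsWithin 0 (Set.Ioi 0)) (nhds (G z))) ∧
      ContinuousOn G closedStrip ∧
      DifferentiableOn ℂ G openStrip ∧
      (∀ t s : ℝ, 0 ≤ s → s ≤ 1 →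
        ‖G ((t : ℂ) + (s : ℂ) * Complex.I)‖ ≤ A + B * |t|) := by
  let a : SchwartzMap ℝ ℂ := 𝓕 (f.postcompCLM Complex.ofRealCLM)
  let b : SchwartzMap ℝ ℂ := 𝓕 (g.postcompCLM Complex.ofRealCLM)
  have ha : 𝓕 (fun x : ℝ => (f x : ℂ)) = a := by
    rw [SchwartzMap.fourier_coe]; rfl
  have hb : 𝓕 (fun x : ℝ => (g x : ℂ)) = b := by
    rw [SchwartzMap.fourier_coe]; rfl
  obtain ⟨Ca, hCa, a0, a1⟩ := PVaux.schwartz_bounds a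
  obtain ⟨Cb, hCb, b0, b1⟩ := PVaux.schwartz_bounds b
  have bb : ∀ p, ‖b p‖ ≤ Cb := fun p => by
    refine le_trans (le_mul_of_one_le_left (norm_nonneg _) ?_) (b0 p)
    exact one_le_pow₀ (by linarith [abs_nonneg p])
  have ab : ∀ p, ‖a p‖ ≤ Ca := fun p => by
    refine le_trans (le_mul_of_one_le_left (norm_nonneg _) ?_) (a0 p)
    exact one_le_pow₀ (by linarith [abs_nonneg p])
  let h : ℝ → ℂ := fun p => a p * (starRingEnd ℂ) (b p)
  have hc : Continuous h := a.continuous.mul (Complex.continuous_conj.comp b.continuous)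
  set K := Ca * Cb with hK
  have hK0 : 0 ≤ K := by positivity
  have h0 : ∀ p : ℝ, (1 + |p|) ^ 4 * ‖h p‖ ≤ K := fun p => by
    have : ‖h p‖ = ‖a p‖ * ‖b p‖ := by simp [h]
    rw [this, ← mul_assoc]
    exact mul_le_mul (a0 p) (bb p) (norm_nonneg _) hCa
  have hl : ∀ p : ℝ, 0 < p → ‖h p - h (-p)‖ ≤ 4 * K * p := fun p hp => by
    have e : h p - h (-p) = (a p - a (-p)) * (starRingEnd ℂ) (b p) +
      a (-p) * (starRingEnd ℂ) (b p - b (-p)) := by simp [h]; ring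
    have e2 : |p - -p| = 2 * p := by rw [abs_of_pos] <;> linarith
    rw [e]
    refine (norm_add_le _ _).trans ?_
    rw [norm_mul, norm_mul, RCLike.norm_conj, RCLike.norm_conj]
    have x1 := a1 p (-p)
    have x2 := b1 p (-p)
    rw [e2] at x1 x2
    have y1 := mul_le_mul x1 (bb p) (norm_nonneg _) (by positivity)
    have y2 := mul_le_mul (ab (-p)) x2 (norm_nonneg _) hCa
    rw [hK]
    linarith
  have hsq : ∀ p : ℝ, 1 + p ^ 2 ≤ (1 + |p|) ^ 2 := fun p => by
    have := abs_nonneg p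
    rw [← sq_abs]; nlinarith
  have hD : ∀ p : ℝ, (1 + |p|) * ((1 + |p|) * ‖h p‖) ≤ K * (1 + p ^ 2)⁻¹ := fun p => by
    have hp : 0 < 1 + p ^ 2 := by positivity
    rw [← div_eq_mul_inv, le_div_iff₀ hp]
    refine le_trans ?_ (h0 p)
    calc (1 + |p|) * ((1 + |p|) * ‖h p‖) * (1 + p ^ 2)
        ≤ (1 + |p|) * ((1 + |p|) * ‖h p‖) * (1 + |p|) ^ 2 := by gcongr; exact hsq p
      _ = _ := by ring
  have hfin := PVaux.main hc (C := 16 * K) ?_ ?_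
  · simp only [ha, hb]
    simpa only [PVaux.F, h, mul_assoc] using hfin
  · intro p
    have h3 : (1 + |p|) * ‖h p‖ ≤ (1 + |p|) * ((1 + |p|) * ‖h p‖) :=
      le_mul_of_one_le_left (by positivity) (by linarith [abs_nonneg p])
    have h4 : 0 ≤ K * (1 + p ^ 2)⁻¹ := by positivity
    linarith [hD p]
  · intro p hp
    have hq : 0 < 1 + p ^ 2 := by positivity
    rcases le_total p 1 with h5 | h5
    · have h6 : (1 : ℝ) ≤ 2 * (1 + p ^ 2)⁻¹ := by
        rw [← div_eq_mul_inv, le_div_iff₀ hq]; nlinarith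
      calc (1 + p) * ‖h p - h (-p)‖ ≤ 2 * (4 * K * p) := by
            gcongr
            · linarith
            · exact hl p hp
        _ = 8 * K * p * 1 := by ring
        _ ≤ 8 * K * p * (2 * (1 + p ^ 2)⁻¹) := by gcongr
        _ = _ := by ring
    · have z1 := hD p
      have z2 := hD (-p)
      rw [abs_neg, neg_sq] at z2
      rw [abs_of_pos hp] at z1 z2
      have w1 : (1 + p) * ‖h p‖ ≤ (1 + p) * ((1 + p) * ‖h p‖) :=
        le_mul_of_one_le_left (by positivity) (by linarith)
      have w2 : (1 + p) * ‖h (-p)‖ ≤ (1 + p) * ((1 + p) * ‖h (-p)‖) :=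
        le_mul_of_one_le_left (by positivity) (by linarith)
      have h4 : 0 ≤ K * (1 + p ^ 2)⁻¹ := by positivity
      calc (1 + p) * ‖h p - h (-p)‖ ≤ (1 + p) * (‖h p‖ + ‖h (-p)‖) := by
            gcongr; exact norm_sub_le _ _
        _ ≤ 16 * K * (1 + p ^ 2)⁻¹ := by linarith
        _ ≤ p * (16 * K * (1 + p ^ 2)⁻¹) := le_mul_of_one_le_left (by positivity) h5
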